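/- Let H be an elementary abelian 2-hypergroup built from p involutions, p♯ of which are thick, and let F, G be closed subsets of H. Then F ≃ G if and only if at least two of the equalities s(F) = s(G), r_2(F) = r_2(G), |F| = |G| hold. Moreover, there are exactly p·p♯ − (p♯)² + p + 1 pairwise distinct ≃-equivalence classes of closed subsets of H, and the ≃-equivalence class containing F has cardinality C(p♯, s(F)) · C(p−p♯, r_2(F))_2, where C(·,·) is the ordinary binomial coefficient and C(·,·)_2 the Gaussian binomial coefficient with base 2. -/

import Mathlib

namespace HyperPaper

/-- A hypergroup: hypermultiplication `hmul`, inversion `star`, identity `e`,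
satisfying (H1) associativity, (H2) unique two-sided identity, (H3) exchange conditions. -/
structure Hypergroup (H : Type*) where
  hmul : H → H → Set H
  star : H → H
  e : H
  idl : ∀ p, hmul e p = {p}
  idr : ∀ p, hmul p e = {p}
  e_unique : ∀ e' : H, (∀ p, hmul e' p = {p} ∧ hmul p e' = {p}) → e' = e
  assoc : ∀ p q r : H, (⋃ x ∈ hmul p q, hmul x r) = ⋃ x ∈ hmul q r, hmul p x
  h3l : ∀ p q r : H, p ∈ hmul q r ↔ q ∈ hmul p (star r)
  h3r : ∀ p q r : H, p ∈ hmul q r ↔ r ∈ hmul (star q) p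

variable {H : Type*}

namespace Hypergroup

/-- Product of two subsets: FG = {a : ∃ b ∈ F, c ∈ G, a ∈ bc}. -/
def smul (hg : Hypergroup H) (F G : Set H) : Set H :=
  {a | ∃ b ∈ F, ∃ c ∈ G, a ∈ hg.hmul b c}

/-- Closed subset: nonempty and G*G ⊆ G. -/
def IsClosed (hg : Hypergroup H) (G : Set H) : Prop :=
  G.Nonempty ∧ hg.smul (hg.star '' G) G ⊆ G

/-- Thin element: p*p = {e}. -/
def IsThin (hg : Hypergroup H) (p : H) : Prop := hg.hmul (hg.star p) p = {hg.e}

/-- Thick element: not thin. -/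
def IsThick (hg : Hypergroup H) (p : H) : Prop := ¬ hg.IsThin p

/-- Involution: p ≠ e and {e, p} is closed. -/
def IsInvolution (hg : Hypergroup H) (p : H) : Prop :=
  p ≠ hg.e ∧ hg.IsClosed {hg.e, p}

/-- ⟨G⟩: smallest closed subset containing G. -/
def gen (hg : Hypergroup H) (G : Set H) : Set H := ⋂₀ {C | hg.IsClosed C ∧ G ⊆ C}

/-- O_ϑ(G): the thin elements of H lying in G. -/
def Othin (hg : Hypergroup H) (G : Set H) : Set H := {p ∈ G | hg.IsThin p}

/-- F is a strongly normal closed subset of G: p*Fp ⊆ F ⊆ G for all p ∈ G. -/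
def IsStronglyNormal (hg : Hypergroup H) (F G : Set H) : Prop :=
  hg.IsClosed F ∧ hg.IsClosed G ∧ F ⊆ G ∧
    ∀ p ∈ G, hg.smul (hg.smul {hg.star p} F) {p} ⊆ F

/-- O^ϑ(G): intersection of all strongly normal closed subsets of ⟨G⟩. -/
def Osup (hg : Hypergroup H) (G : Set H) : Set H :=
  ⋂₀ {F | hg.IsStronglyNormal F (hg.gen G)}

/-- F is a normal closed subset of G. -/
def IsNormal (hg : Hypergroup H) (F G : Set H) : Prop :=
  hg.IsClosed F ∧ hg.IsClosed G ∧ F ⊆ G ∧ ∀ p ∈ G, hg.smul F {p} = hg.smul {p} F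

/-- Product of a list of subsets (empty product is {e}). -/
def listProd (hg : Hypergroup H) : List (Set H) → Set H
  | [] => {hg.e}
  | a :: l => hg.smul a (hg.listProd l)

/-- Product r_1 r_2 ⋯ r_n of a family of elements. -/
def famProd (hg : Hypergroup H) {n : ℕ} (r : Fin n → H) : Set H :=
  hg.listProd ((List.finRange n).map fun i => ({r i} : Set H))

/-- Ĝ_i: the product of the G_j with j ≠ i. -/
def cofactor (hg : Hypergroup H) {n : ℕ} (G : Fin n → Set H) (i : Fin n) : Set H :=
  hg.listProd (((List.finRange n).filter fun j => decide (j ≠ i)).map G)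

/-- H is the direct product of the normal closed subsets G_1, …, G_n. -/
def IsDirectProduct (hg : Hypergroup H) {n : ℕ} (G : Fin n → Set H) : Prop :=
  (∀ i, hg.IsNormal (G i) Set.univ) ∧
  (∀ i, hg.smul (G i) (hg.cofactor G i) = Set.univ) ∧
  (∀ i, G i ∩ hg.cofactor G i = {hg.e})

/-- r : Fin n → H is a decomposition of x with respect to the family G. -/
def IsDecomp (hg : Hypergroup H) {n : ℕ} (G : Fin n → Set H) (x : H) (r : Fin n → H) : Prop :=
  (∀ i, r i ∈ G i) ∧ x ∈ hg.famProd r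

/-- The support of x: the elements ≠ e appearing in the decomposition of x. -/
def dsupport (hg : Hypergroup H) {n : ℕ} (G : Fin n → Set H) (x : H) : Set H :=
  {y | y ≠ hg.e ∧ ∃ r, hg.IsDecomp G x r ∧ y ∈ Set.range r}

/-- The cover of x: the product r_1r_2⋯r_n for the decomposition of x. -/
def dcover (hg : Hypergroup H) {n : ℕ} (G : Fin n → Set H) (x : H) : Set H :=
  {y | ∃ r, hg.IsDecomp G x r ∧ y ∈ hg.famProd r}

/-- x is constrained: its cover equals {x}. -/
def IsConstrained (hg : Hypergroup H) {n : ℕ} (G : Fin n → Set H) (x : H) : Prop :=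
  hg.dcover G x = {x}

/-- r_2(G): the largest 2-rank of a thin closed subset of H contained in G
(equivalently, the largest k such that G contains a thin symmetric closed subset
of 2^k elements, which corresponds to an elementary abelian 2-group of 2-rank k). -/
noncomputable def rank2 (hg : Hypergroup H) (G : Set H) : ℕ :=
  sSup {k | ∃ U : Set H, hg.IsClosed U ∧ U ⊆ G ∧ (∀ u ∈ U, hg.IsThin u) ∧
    (∀ u ∈ U, hg.star u = u) ∧ U.ncard = 2 ^ k}

/-- F is a minimal generating subset of G. -/
def IsMinGen (hg : Hypergroup H) (G F : Set H) : Prop :=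
  F ⊆ G ∧ hg.gen F = G ∧ ∀ p ∈ F, hg.gen (F \ {p}) ≠ G

/-- The dimension of G: the smallest cardinality of a minimal generating subset. -/
noncomputable def dimension (hg : Hypergroup H) (G : Set H) : ℕ :=
  sInf {k | ∃ F : Set H, hg.IsMinGen G F ∧ F.Finite ∧ F.ncard = k}

/-- [F, G] = ⟨{a : ∃ b ∈ F, c ∈ G, a ∈ b*c*bc}⟩. -/
def commSet (hg : Hypergroup H) (F G : Set H) : Set H :=
  hg.gen {a | ∃ b ∈ F, ∃ c ∈ G,
    a ∈ hg.smul (hg.smul (hg.smul {hg.star b} {hg.star c}) {b}) {c}}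

/-- derived G k = G^{(k+1)}: G^{(1)} = G, G^{(r)} = [G^{(r-1)}, G]. -/
def derived (hg : Hypergroup H) (G : Set H) : ℕ → Set H
  | 0 => G
  | k + 1 => hg.commSet (hg.derived G k) G

/-- G is nilpotent: G^{(r)} = {e} for some r. -/
def IsNilpotent (hg : Hypergroup H) (G : Set H) : Prop :=
  ∃ k : ℕ, hg.derived G k = {hg.e}

/-- G is a residually thin closed subset: there is a chain {e} = F_1, …, F_n = G of
pairwise distinct closed subsets, each strongly normal in the next. -/
def IsResiduallyThin (hg : Hypergroup H) (G : Set H) : Prop :=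
  ∃ (m : ℕ) (F : Fin (m + 1) → Set H), Function.Injective F ∧
    F 0 = {hg.e} ∧ F (Fin.last m) = G ∧
    ∀ i : Fin m, hg.IsStronglyNormal (F i.castSucc) (F i.succ)

/-- x^k as a subset: x^0 = {e}, x^{k+1} = x^k · x. -/
def spow (hg : Hypergroup H) (x : H) : ℕ → Set H
  | 0 => {hg.e}
  | k + 1 => hg.smul (hg.spow x k) {x}

/-- F is a maximal closed subset of G. -/
def IsMaximalClosed (hg : Hypergroup H) (F G : Set H) : Prop :=
  hg.IsClosed F ∧ hg.IsClosed G ∧ F ⊆ G ∧ F ≠ G ∧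
    ∀ E : Set H, hg.IsClosed E → F ⊆ E → E ⊆ G → E = F ∨ E = G

/-- The Frattini closed subset of G: the intersection (inside G) of all maximal
closed subsets of G. -/
def frattini (hg : Hypergroup H) (G : Set H) : Set H :=
  G ∩ ⋂₀ {F | hg.IsMaximalClosed F G}

/-- α is an isomorphism from the closed subset F to the closed subset G. -/
def IsIso (hg : Hypergroup H) (F G : Set H) (α : H → H) : Prop :=
  Set.BijOn α F G ∧ α hg.e = hg.e ∧
    ∀ p ∈ F, ∀ q ∈ F, α '' hg.hmul p q = hg.hmul (α p) (α q)

/-- F ≃ G: there is an isomorphism from F to G. -/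
def Isomorphic (hg : Hypergroup H) (F G : Set H) : Prop := ∃ α : H → H, hg.IsIso F G α

/-- Aut(G): the automorphism group of G, realized as the subgroup of permutations of G
that fix e and preserve the hypermultiplication. -/
def autGroup (hg : Hypergroup H) (G : Set H) : Subgroup (Equiv.Perm G) where
  carrier := {σ | (∀ x : G, (x : H) = hg.e → ((σ x : H)) = hg.e) ∧
    ∀ p q x : G, (x : H) ∈ hg.hmul p q ↔ ((σ x : H)) ∈ hg.hmul (σ p) (σ q)}
  one_mem' := by
    constructor
    · intro x hx; simpa using hx
    · intro p q x; simp
  mul_mem' := by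
    rintro σ τ ⟨he1, hm1⟩ ⟨he2, hm2⟩
    refine ⟨fun x hx => ?_, fun p q x => ?_⟩
    · simpa using he1 _ (he2 x hx)
    · simpa using (hm2 p q x).trans (hm1 (τ p) (τ q) (τ x))
  inv_mem' := by
    rintro σ ⟨he, hm⟩
    refine ⟨fun x hx => ?_, fun p q x => ?_⟩
    · have h2 : σ x = x := Subtype.ext ((he x hx).trans hx.symm)
      have h3 : σ⁻¹ x = x := by
        conv_lhs => rw [← h2]
        simp
      rw [h3]; exact hx
    · have h := hm (σ⁻¹ p) (σ⁻¹ q) (σ⁻¹ x)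
      simpa using h.symm

end Hypergroup

/-- An elementary abelian 2-hypergroup: a hypergroup that is the constrained direct
product of the closed subsets ⟨q_1⟩, …, ⟨q_n⟩ generated by involutions q_1, …, q_n. -/
structure EA2Data (H : Type*) where
  hg : Hypergroup H
  n : ℕ
  q : Fin n → H
  invol : ∀ i, hg.IsInvolution (q i)
  dp : hg.IsDirectProduct fun i => hg.gen {q i}
  constrained : ∀ x : H, hg.IsConstrained (fun i => hg.gen {q i}) x

namespace EA2Data

/-- The family ⟨q_1⟩, …, ⟨q_n⟩. -/
def fam (E : EA2Data H) : Fin E.n → Set H := fun i => E.hg.gen {E.q i}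

/-- The support of x. -/
def support (E : EA2Data H) (x : H) : Set H := E.hg.dsupport E.fam x

/-- Thick(F): externally thick elements of H lying in F. -/
def ThickIn (E : EA2Data H) (F : Set H) : Set H :=
  {x ∈ F | x = E.hg.e ∨ ∀ y ∈ E.support x, E.hg.IsThick y}

/-- Thin(F): externally thin elements of H lying in F. -/
def ThinIn (E : EA2Data H) (F : Set H) : Set H :=
  {x ∈ F | x = E.hg.e ∨ ∀ y ∈ E.support x, E.hg.IsThin y}

/-- The (unique) pair (x⁺, x⁻) with x⁺ ∈ Thick(H), x⁻ ∈ Thin(H), x⁺x⁻ = {x}. -/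
noncomputable def pm (E : EA2Data H) (x : H) : H × H :=
  @Classical.epsilon (H × H) ⟨(E.hg.e, E.hg.e)⟩ fun z =>
    z.1 ∈ E.ThickIn Set.univ ∧ z.2 ∈ E.ThinIn Set.univ ∧ E.hg.hmul z.1 z.2 = {x}

/-- x⁺. -/
noncomputable def plus (E : EA2Data H) (x : H) : H := (E.pm x).1

/-- x⁻. -/
noncomputable def minus (E : EA2Data H) (x : H) : H := (E.pm x).2

/-- s(x): the number of thick elements of H in the support of x. -/
noncomputable def sElem (E : EA2Data H) (x : H) : ℕ :=
  {y ∈ E.support x | E.hg.IsThick y}.ncard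

/-- s(G) = max {s(a) : a ∈ G}. -/
noncomputable def sSet (E : EA2Data H) (G : Set H) : ℕ :=
  sSup {k | ∃ a ∈ G, E.sElem a = k}

/-- x ⪯ y: the support of x is contained in the support of y. -/
def ple (E : EA2Data H) (x y : H) : Prop := E.support x ⊆ E.support y

/-- p♯: the number of thick elements among q_1, …, q_n. -/
noncomputable def psharp (E : EA2Data H) : ℕ := {i : Fin E.n | E.hg.IsThick (E.q i)}.ncard

end EA2Data

/-- The Gaussian binomial coefficient C(n, k)_2 with base 2, via the
q-Pascal recurrence C(n, k)_2 = C(n-1, k-1)_2 + 2^k · C(n-1, k)_2. -/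
def gaussBinom2 : ℕ → ℕ → ℕ
  | _, 0 => 1
  | 0, _ + 1 => 0
  | n + 1, k + 1 => gaussBinom2 n k + 2 ^ (k + 1) * gaussBinom2 n (k + 1)

end HyperPaper

open HyperPaper

namespace HyperPaper

section GaussianBinomial

theorem gaussBinom2_eq_zero_of_lt {n k : ℕ} (h : n < k) : gaussBinom2 n k = 0 := by
  induction n generalizing k with
  | zero =>
    obtain ⟨k, rfl⟩ := Nat.exists_eq_succ_of_ne_zero h.ne'
    simp [gaussBinom2]
  | succ n ih =>
    obtain ⟨k, rfl⟩ := Nat.exists_eq_succ_of_ne_zero (Nat.ne_zero_of_lt h)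
    simp [gaussBinom2, ih (show n < k by omega), ih (show n < k + 1 by omega)]

theorem prod_two_pow_succ_sub (n k : ℕ) :
    ∏ i ∈ Finset.range (k + 1), ((2 : ℤ) ^ (n + 1) - 2 ^ i) =
      (2 ^ (n + 1) - 1) * 2 ^ k * ∏ i ∈ Finset.range k, ((2 : ℤ) ^ n - 2 ^ i) := by
  have h : ∀ i, ((2 : ℤ) ^ (n + 1) - 2 ^ (i + 1)) = 2 * (2 ^ n - 2 ^ i) := fun i => by ring
  rw [Finset.prod_range_succ', Finset.prod_congr rfl fun i _ => h i, Finset.prod_mul_distrib]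
  simp only [Finset.prod_const, Finset.card_range, pow_zero]
  ring

theorem gaussBinom2_mul_prod (n k : ℕ) :
    (gaussBinom2 n k : ℤ) * ∏ i ∈ Finset.range k, ((2 : ℤ) ^ k - 2 ^ i) =
      ∏ i ∈ Finset.range k, ((2 : ℤ) ^ n - 2 ^ i) := by
  induction n generalizing k with
  | zero =>
    cases k with
    | zero => simp [gaussBinom2]
    | succ k =>
      rw [Finset.prod_range_succ' (fun i => (2 : ℤ) ^ 0 - 2 ^ i)]
      simp [gaussBinom2]
  | succ n ih =>
    cases k with
    | zero => simp [gaussBinom2]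
    | succ k =>
      have h1 := ih k
      have h2 := ih (k + 1)
      have hD := prod_two_pow_succ_sub k k
      rw [Finset.prod_range_succ (fun i => (2 : ℤ) ^ n - 2 ^ i)] at h2
      rw [prod_two_pow_succ_sub n k]
      simp only [gaussBinom2]
      push_cast
      rw [add_mul, mul_assoc (2 ^ (k + 1) : ℤ), h2, hD, ← h1]
      ring

/-- A linearly independent `k`-tuple is the same as a `k`-dimensional subspace together with a
linearly independent `k`-tuple in it. -/
noncomputable def linearIndependentEquivSigma (K V : Type*) [DivisionRing K] [AddCommGroup V]
    [Module K V] (k : ℕ) [FiniteDimensional K V] :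
    {s : Fin k → V // LinearIndependent K s} ≃
      Σ W : {W : Submodule K V // Module.finrank K W = k},
        {s : Fin k → W.1 // LinearIndependent K s} where
  toFun s := ⟨⟨Submodule.span K (Set.range s.1), by simpa using finrank_span_eq_card s.2⟩,
    ⟨fun i => ⟨s.1 i, Submodule.subset_span ⟨i, rfl⟩⟩,
      LinearIndependent.of_comp (Submodule.subtype _) s.2⟩⟩
  invFun p := ⟨fun i => (p.2.1 i : V), p.2.2.map' (Submodule.subtype _) (Submodule.ker_subtype _)⟩
  left_inv s := rfl
  right_inv p := by
    have key : ∀ p q : Σ W : {W : Submodule K V // Module.finrank K W = k},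
        {s : Fin k → W.1 // LinearIndependent K s},
        p.1 = q.1 → (∀ i, (p.2.1 i : V) = q.2.1 i) → p = q := by
      rintro ⟨W, s⟩ ⟨W', t⟩ (rfl : W = W') h
      congr
      exact Subtype.ext (funext fun i => Subtype.ext (h i))
    have hs' := p.2.2.map' p.1.1.subtype (Submodule.ker_subtype _)
    refine key _ _ (Subtype.ext (Submodule.eq_of_le_of_finrank_eq ?_ ?_)) fun i => rfl
    · refine Submodule.span_le.2 ?_
      rintro _ ⟨i, rfl⟩
      exact (p.2.1 i).2
    · exact (finrank_span_eq_card hs').trans ((Fintype.card_fin k).trans p.1.2.symm)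

theorem card_submodule_finrank_eq (V : Type*) [AddCommGroup V] [Module (ZMod 2) V] [Finite V]
    (k : ℕ) :
    {W : Submodule (ZMod 2) V | Module.finrank (ZMod 2) W = k}.ncard =
      gaussBinom2 (Module.finrank (ZMod 2) V) k := by
  classical
  rcases lt_or_ge (Module.finrank (ZMod 2) V) k with hk | hk
  · rw [gaussBinom2_eq_zero_of_lt hk, Set.ncard_eq_zero (Set.toFinite _),
      Set.eq_empty_iff_forall_notMem]
    rintro W rfl
    exact absurd (Submodule.finrank_le W) (not_le.2 hk)
  have hcard := Nat.card_congr (linearIndependentEquivSigma (ZMod 2) V k)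
  have : Fintype {W : Submodule (ZMod 2) V // Module.finrank (ZMod 2) W = k} := Fintype.ofFinite _
  have hW : ∀ W : {W : Submodule (ZMod 2) V // Module.finrank (ZMod 2) W = k},
      Nat.card {s : Fin k → W.1 // LinearIndependent (ZMod 2) s} =
        ∏ i : Fin k, (2 ^ k - 2 ^ i.val) := by
    rintro ⟨W, hW⟩
    rw [card_linearIndependent hW.ge, hW, ZMod.card]
  rw [card_linearIndependent hk, Nat.card_sigma, Finset.sum_congr rfl fun W _ => hW W,
    Finset.sum_const, Finset.card_univ, smul_eq_mul, ZMod.card, ← Nat.card_eq_fintype_card,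
    Fin.prod_univ_eq_prod_range (fun i => 2 ^ Module.finrank (ZMod 2) V - 2 ^ i),
    Fin.prod_univ_eq_prod_range (fun i => 2 ^ k - 2 ^ i)] at hcard
  have hcast : ∀ m, k ≤ m → ((∏ i ∈ Finset.range k, (2 ^ m - 2 ^ i) : ℕ) : ℤ) =
      ∏ i ∈ Finset.range k, ((2 : ℤ) ^ m - 2 ^ i) := by
    intro m hm
    rw [Nat.cast_prod]
    refine Finset.prod_congr rfl fun i hi => ?_
    rw [Nat.cast_sub (Nat.pow_le_pow_right two_pos ((Finset.mem_range.1 hi).le.trans hm))]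
    push_cast
    rfl
  have hZ := congrArg (Nat.cast : ℕ → ℤ) hcard
  rw [Nat.cast_mul, hcast _ hk, hcast _ le_rfl, ← gaussBinom2_mul_prod] at hZ
  have hne : ∏ i ∈ Finset.range k, ((2 : ℤ) ^ k - 2 ^ i) ≠ 0 := by
    refine Finset.prod_ne_zero_iff.2 fun i hi => sub_ne_zero.2 (ne_of_gt ?_)
    exact pow_lt_pow_right₀ one_lt_two (Finset.mem_range.1 hi)
  rw [← Nat.card_coe_set_eq]
  exact_mod_cast (mul_right_cancel₀ hne hZ).symm

theorem exists_submodule_finrank_eq {K V : Type*} [DivisionRing K] [AddCommGroup V] [Module K V]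
    [FiniteDimensional K V] {k : ℕ} (hk : k ≤ Module.finrank K V) :
    ∃ W : Submodule K V, Module.finrank K W = k := by
  have hli := (Module.finBasis K V).linearIndependent.comp _ (Fin.castLE_injective hk)
  exact ⟨_, by simpa using finrank_span_eq_card hli⟩

end GaussianBinomial

namespace Hypergroup

variable {H : Type*} (hg : Hypergroup H)

theorem e_mem_hmul_iff {p q : H} : hg.e ∈ hg.hmul p q ↔ p = hg.star q := by
  rw [hg.h3l, hg.idl, Set.mem_singleton_iff]

theorem e_mem_star_hmul (p : H) : hg.e ∈ hg.hmul (hg.star p) p :=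
  hg.e_mem_hmul_iff.2 rfl

theorem e_mem_of_isClosed {G : Set H} (hG : hg.IsClosed G) : hg.e ∈ G := by
  obtain ⟨⟨g, hg'⟩, h⟩ := hG
  exact h ⟨_, ⟨g, hg', rfl⟩, g, hg', hg.e_mem_star_hmul g⟩

theorem hmul_nonempty (p q : H) : (hg.hmul p q).Nonempty := by
  have h : q ∈ ⋃ x ∈ hg.hmul (hg.star p) p, hg.hmul x q :=
    Set.mem_biUnion (hg.e_mem_star_hmul p) (by simp [hg.idl])
  rw [hg.assoc] at h
  obtain ⟨x, hx, -⟩ := Set.mem_iUnion₂.1 h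
  exact ⟨x, hx⟩

/-- Coordinates on a hypergroup in which every element is self-inverse: an element is a finite set
of thick involutions together with a vector over `ZMod 2`. -/
structure Coordinates (hg : Hypergroup H) (I T : Type*) where
  toEquiv : Finset I × (T → ZMod 2) ≃ H
  mem_hmul : ∀ A B C u v w, toEquiv (C, w) ∈ hg.hmul (toEquiv (A, u)) (toEquiv (B, v)) ↔
    (∀ i, (i ∈ A ↔ i ∈ B) ∨ i ∈ C) ∧ (∀ i ∈ C, i ∈ A ∨ i ∈ B) ∧ w = u + v

namespace Coordinates

variable {hg} {I T : Type*} (c : hg.Coordinates I T)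

theorem add_self_eq_zero (u : T → ZMod 2) : u + u = 0 :=
  funext fun t => CharTwo.add_self_eq_zero (u t)

theorem toEquiv_zero : c.toEquiv (∅, 0) = hg.e := by
  obtain ⟨⟨A, u⟩, h⟩ := c.toEquiv.surjective hg.e
  have h1 : hg.e ∈ hg.hmul hg.e hg.e := by simp [hg.idl]
  have h3 := (c.mem_hmul A A ∅ u u 0).2 ⟨by simp, by simp, (add_self_eq_zero u).symm⟩
  rw [h, hg.idl] at h3
  exact h3

theorem e_mem_hmul_self (c : hg.Coordinates I T) (x : H) : hg.e ∈ hg.hmul x x := by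
  obtain ⟨⟨A, u⟩, rfl⟩ := c.toEquiv.surjective x
  rw [← c.toEquiv_zero, c.mem_hmul]
  exact ⟨by simp, by simp, (add_self_eq_zero u).symm⟩

theorem star_eq (c : hg.Coordinates I T) (x : H) : hg.star x = x :=
  (hg.e_mem_hmul_iff.1 (c.e_mem_hmul_self x)).symm

theorem isClosed_iff (c : hg.Coordinates I T) {G : Set H} :
    hg.IsClosed G ↔ hg.e ∈ G ∧ ∀ x ∈ G, ∀ y ∈ G, hg.hmul x y ⊆ G := by
  constructor
  · refine fun h => ⟨hg.e_mem_of_isClosed h, fun x hx y hy z hz => h.2 ⟨x, ?_, y, hy, hz⟩⟩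
    exact ⟨x, hx, c.star_eq x⟩
  · rintro ⟨he, h⟩
    refine ⟨⟨_, he⟩, ?_⟩
    rintro z ⟨_, ⟨x, hx, rfl⟩, y, hy, hz⟩
    rw [c.star_eq] at hz
    exact h x hx y hy hz

theorem isThin_iff (A : Finset I) (u : T → ZMod 2) : hg.IsThin (c.toEquiv (A, u)) ↔ A = ∅ := by
  rw [IsThin, c.star_eq]
  constructor
  · intro h
    have h1 : c.toEquiv (A, 0) ∈ hg.hmul (c.toEquiv (A, u)) (c.toEquiv (A, u)) :=
      (c.mem_hmul ..).2 ⟨by simp, by simp, (add_self_eq_zero u).symm⟩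
    rw [h, Set.mem_singleton_iff, ← c.toEquiv_zero, c.toEquiv.apply_eq_iff_eq, Prod.mk.injEq] at h1
    exact h1.1
  · rintro rfl
    ext x
    obtain ⟨⟨B, v⟩, rfl⟩ := c.toEquiv.surjective x
    rw [c.mem_hmul, Set.mem_singleton_iff, ← c.toEquiv_zero, c.toEquiv.apply_eq_iff_eq,
      Prod.mk.injEq, add_self_eq_zero, Finset.eq_empty_iff_forall_notMem]
    simp

/-- The closed subset consisting of the elements supported in `S` and `W`. -/
def box (S : Finset I) (W : Submodule (ZMod 2) (T → ZMod 2)) : Set H :=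
  c.toEquiv '' ((S.powerset : Set (Finset I)) ×ˢ (W : Set (T → ZMod 2)))

theorem mem_box {S A : Finset I} {W : Submodule (ZMod 2) (T → ZMod 2)} {u : T → ZMod 2} :
    c.toEquiv (A, u) ∈ c.box S W ↔ A ⊆ S ∧ u ∈ W := by
  simp [box]

theorem box_injective : Function.Injective fun p : Finset I × Submodule (ZMod 2) (T → ZMod 2) =>
    c.box p.1 p.2 := by
  rintro ⟨S, W⟩ ⟨S', W'⟩ h
  have h' : ∀ A u, (A ⊆ S ∧ u ∈ W) ↔ (A ⊆ S' ∧ u ∈ W') := fun A u => by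
    rw [← c.mem_box, ← c.mem_box]
    exact iff_of_eq (congrArg (c.toEquiv (A, u) ∈ ·) h)
  refine Prod.ext (Finset.Subset.antisymm ?_ ?_) (SetLike.ext fun u => ?_)
  · exact ((h' S 0).1 ⟨subset_rfl, W.zero_mem⟩).1
  · exact ((h' S' 0).2 ⟨subset_rfl, W'.zero_mem⟩).1
  · simpa using h' ∅ u

theorem isClosed_box (S : Finset I) (W : Submodule (ZMod 2) (T → ZMod 2)) :
    hg.IsClosed (c.box S W) := by
  refine c.isClosed_iff.2 ⟨?_, ?_⟩
  · rw [← c.toEquiv_zero, c.mem_box]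
    exact ⟨Finset.empty_subset _, W.zero_mem⟩
  · intro x hx y hy z hz
    obtain ⟨⟨A, u⟩, rfl⟩ := c.toEquiv.surjective x
    obtain ⟨⟨B, v⟩, rfl⟩ := c.toEquiv.surjective y
    obtain ⟨⟨C, w⟩, rfl⟩ := c.toEquiv.surjective z
    rw [c.mem_box] at *
    rw [c.mem_hmul] at hz
    obtain ⟨-, hC, rfl⟩ := hz
    exact ⟨fun i hi => (hC i hi).elim (fun h => hx.1 h) fun h => hy.1 h, W.add_mem hx.2 hy.2⟩

theorem exists_eq_box [Finite I] {G : Set H} (hG : hg.IsClosed G) :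
    ∃ S W, G = c.box S W := by
  classical
  have := Fintype.ofFinite I
  obtain ⟨he, hmul⟩ := c.isClosed_iff.1 hG
  have hmul' : ∀ {A B C u v w}, c.toEquiv (A, u) ∈ G → c.toEquiv (B, v) ∈ G →
      (∀ i, (i ∈ A ↔ i ∈ B) ∨ i ∈ C) → (∀ i ∈ C, i ∈ A ∨ i ∈ B) → w = u + v →
      c.toEquiv (C, w) ∈ G := fun h1 h2 h3 h4 h5 =>
    hmul _ h1 _ h2 ((c.mem_hmul ..).2 ⟨h3, h4, h5⟩)
  have h0 : c.toEquiv (∅, 0) ∈ G := by rwa [c.toEquiv_zero]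
  let W : AddSubgroup (T → ZMod 2) :=
    { carrier := {u | c.toEquiv (∅, u) ∈ G}
      zero_mem' := h0
      add_mem' := fun ha hb => hmul' ha hb (by simp) (by simp) rfl
      neg_mem' := fun {u} ha => by
        rwa [Set.mem_ofPred_eq, neg_eq_of_add_eq_zero_left (add_self_eq_zero u)] }
  let S : Finset I := Finset.univ.filter fun i => ∃ A u, c.toEquiv (A, u) ∈ G ∧ i ∈ A
  have hsquare : ∀ {A u}, c.toEquiv (A, u) ∈ G → ∀ C ⊆ A, c.toEquiv (C, 0) ∈ G :=
    fun h C hC => hmul' h h (by simp) (fun i hi => Or.inl (hC hi))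
      (add_self_eq_zero _).symm
  have hS : ∀ A ⊆ S, c.toEquiv (A, 0) ∈ G := by
    intro A
    induction A using Finset.induction_on with
    | empty => exact fun _ => h0
    | insert i A hi ih =>
      intro hA
      rw [Finset.insert_subset_iff] at hA
      obtain ⟨B, u, hB, hiB⟩ := (Finset.mem_filter.1 hA.1).2
      have h1 := hsquare hB {i} (by simpa using hiB)
      refine hmul' h1 (ih hA.2) (fun j => ?_) (fun j => ?_) (add_zero _).symm
      · simp only [Finset.mem_singleton, Finset.mem_insert]
        tauto
      · simp
  refine ⟨S, AddSubgroup.toZModSubmodule 2 W, ?_⟩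
  ext x
  obtain ⟨⟨A, u⟩, rfl⟩ := c.toEquiv.surjective x
  rw [c.mem_box, AddSubgroup.mem_toZModSubmodule]
  constructor
  · intro h
    refine ⟨fun i hi => Finset.mem_filter.2 ⟨Finset.mem_univ _, A, u, h, hi⟩, ?_⟩
    exact hmul' h (hsquare h A subset_rfl) (by simp) (by simp) (add_zero _).symm
  · rintro ⟨hA, hu⟩
    exact hmul' (hS A hA) hu (fun i => by simp [em']) (by simp) (zero_add _).symm

theorem ncard_box [Finite T] (S : Finset I) (W : Submodule (ZMod 2) (T → ZMod 2)) :
    (c.box S W).ncard = 2 ^ S.card * 2 ^ Module.finrank (ZMod 2) W := by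
  rw [box, Set.ncard_image_of_injective _ c.toEquiv.injective, Set.ncard_prod,
    Set.ncard_coe_finset, Finset.card_powerset]
  congr 1
  rw [← Nat.card_coe_set_eq, SetLike.coe_sort_coe, Module.natCard_eq_pow_finrank (K := ZMod 2),
    Nat.card_zmod]

theorem setOf_isThin_box (S : Finset I) (W : Submodule (ZMod 2) (T → ZMod 2)) :
    {x ∈ c.box S W | hg.IsThin x} = c.box ∅ W := by
  ext x
  obtain ⟨⟨A, u⟩, rfl⟩ := c.toEquiv.surjective x
  simp only [Set.mem_ofPred_eq, c.mem_box, c.isThin_iff, Finset.subset_empty]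
  constructor
  · rintro ⟨⟨-, h⟩, rfl⟩
    exact ⟨rfl, h⟩
  · rintro ⟨rfl, h⟩
    exact ⟨⟨Finset.empty_subset _, h⟩, rfl⟩

theorem finite_box [Finite T] (S : Finset I) (W : Submodule (ZMod 2) (T → ZMod 2)) :
    (c.box S W).Finite :=
  ((Finset.finite_toSet _).prod (Set.toFinite _)).image _

theorem rank2_box [Finite T] (S : Finset I) (W : Submodule (ZMod 2) (T → ZMod 2)) :
    hg.rank2 (c.box S W) = Module.finrank (ZMod 2) W := by
  refine IsGreatest.csSup_eq ⟨⟨c.box ∅ W, c.isClosed_box _ _, ?_, ?_, fun u _ => c.star_eq u, ?_⟩,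
    ?_⟩
  · rw [← c.setOf_isThin_box S]
    exact Set.sep_subset _ _
  · rw [← c.setOf_isThin_box S]
    exact fun u hu => hu.2
  · simp [c.ncard_box]
  · rintro k ⟨U, -, hU, hthin, -, hk⟩
    have h : U ⊆ c.box ∅ W := by
      rw [← c.setOf_isThin_box S]
      exact fun u hu => ⟨hU hu, hthin u hu⟩
    have h' := Set.ncard_le_ncard h (c.finite_box _ _)
    rw [hk, c.ncard_box, Finset.card_empty, pow_zero, one_mul] at h'
    exact (Nat.pow_le_pow_iff_right one_lt_two).1 h'

theorem ncard_box_eq_iff [Finite T] (S : Finset I) (W : Submodule (ZMod 2) (T → ZMod 2))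
    (S' : Finset I) (W' : Submodule (ZMod 2) (T → ZMod 2)) :
    (c.box S W).ncard = (c.box S' W').ncard ↔
      S.card + Module.finrank (ZMod 2) W = S'.card + Module.finrank (ZMod 2) W' := by
  rw [c.ncard_box, c.ncard_box, ← pow_add, ← pow_add]
  exact Nat.pow_right_inj one_lt_two

theorem isomorphic_box [Finite T] [Finite I] {S S' : Finset I}
    {W W' : Submodule (ZMod 2) (T → ZMod 2)} (hS : S.card = S'.card)
    (hW : Module.finrank (ZMod 2) W = Module.finrank (ZMod 2) W') :
    hg.Isomorphic (c.box S W) (c.box S' W') := by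
  classical
  have := Fintype.ofFinite I
  let σ : Equiv.Perm I := (Finset.equivOfCardEq hS).extendSubtype
  have hσ : S.map σ.toEmbedding = S' := by
    refine Finset.eq_of_subset_of_card_le (fun j hj => ?_) (by simp [hS])
    obtain ⟨i, hi, rfl⟩ := Finset.mem_map.1 hj
    exact (Finset.equivOfCardEq hS).extendSubtype_mem i hi
  obtain ⟨L, hL⟩ := LinearMap.exists_extend
    (W'.subtype ∘ₗ (LinearEquiv.ofFinrankEq W W' hW).toLinearMap)
  have hL' : ∀ u (hu : u ∈ W), L u = LinearEquiv.ofFinrankEq W W' hW ⟨u, hu⟩ :=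
    fun u hu => LinearMap.congr_fun hL ⟨u, hu⟩
  let α : H → H := fun x => c.toEquiv (((c.toEquiv.symm x).1).map σ.toEmbedding,
    L (c.toEquiv.symm x).2)
  have hα : ∀ A u, α (c.toEquiv (A, u)) = c.toEquiv (A.map σ.toEmbedding, L u) := by simp [α]
  refine ⟨α, ⟨?_, ?_, ?_⟩, ?_, ?_⟩
  · intro x hx
    obtain ⟨⟨A, u⟩, rfl⟩ := c.toEquiv.surjective x
    rw [c.mem_box] at hx
    rw [hα, c.mem_box, hL' u hx.2, ← hσ]
    exact ⟨Finset.map_subset_map.2 hx.1, Subtype.coe_prop _⟩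
  · intro x hx y hy h
    obtain ⟨⟨A, u⟩, rfl⟩ := c.toEquiv.surjective x
    obtain ⟨⟨B, v⟩, rfl⟩ := c.toEquiv.surjective y
    rw [c.mem_box] at hx hy
    rw [hα, hα, c.toEquiv.apply_eq_iff_eq, Prod.mk.injEq, Finset.map_inj, hL' u hx.2, hL' v hy.2,
      Subtype.coe_inj, (LinearEquiv.ofFinrankEq W W' hW).injective.eq_iff, Subtype.mk.injEq] at h
    rw [h.1, h.2]
  · intro x hx
    obtain ⟨⟨A, u⟩, rfl⟩ := c.toEquiv.surjective x
    rw [c.mem_box] at hx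
    obtain ⟨⟨v, hv⟩, hv'⟩ := (LinearEquiv.ofFinrankEq W W' hW).surjective ⟨u, hx.2⟩
    refine ⟨c.toEquiv (A.map σ.symm.toEmbedding, v), c.mem_box.2 ⟨?_, hv⟩, ?_⟩
    · rw [← Finset.map_subset_map (f := σ.toEmbedding), hσ, Finset.map_map]
      convert hx.1
      ext i
      simp
    · rw [hα, hL' v hv, hv', Finset.map_map]
      congr
      ext i
      simp
  · rw [← c.toEquiv_zero, hα]
    simp
  · intro x _ y _
    obtain ⟨⟨A, u⟩, rfl⟩ := c.toEquiv.surjective x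
    obtain ⟨⟨B, v⟩, rfl⟩ := c.toEquiv.surjective y
    ext z
    obtain ⟨⟨C, w⟩, rfl⟩ := c.toEquiv.surjective z
    rw [hα, hα, c.mem_hmul]
    constructor
    · rintro ⟨z', hz', hz⟩
      obtain ⟨⟨D, t⟩, rfl⟩ := c.toEquiv.surjective z'
      rw [hα, c.toEquiv.apply_eq_iff_eq, Prod.mk.injEq] at hz
      rw [c.mem_hmul] at hz'
      obtain ⟨rfl, rfl⟩ := hz
      obtain ⟨h1, h2, rfl⟩ := hz'
      refine ⟨fun i => ?_, fun i => ?_, map_add L u v⟩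
      · simpa only [Finset.mem_map_equiv] using h1 _
      · simpa only [Finset.mem_map_equiv] using h2 _
    · rintro ⟨h1, h2, rfl⟩
      refine ⟨c.toEquiv (C.map σ.symm.toEmbedding, u + v), (c.mem_hmul ..).2
        ⟨fun i => ?_, fun i => ?_, rfl⟩, ?_⟩
      · simpa [Finset.mem_map_equiv] using h1 (σ i)
      · simpa [Finset.mem_map_equiv] using h2 (σ i)
      · rw [hα, map_add, Finset.map_map]
        congr
        ext i
        simp

theorem ncard_isThin_eq_of_isIso (c : hg.Coordinates I T) {F G : Set H}
    (hF : hg.IsClosed F) {α : H → H} (hα : hg.IsIso F G α) :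
    {x ∈ F | hg.IsThin x}.ncard = {x ∈ G | hg.IsThin x}.ncard := by
  obtain ⟨hbij, he, hmul⟩ := hα
  obtain ⟨heF, hclosed⟩ := c.isClosed_iff.1 hF
  have key : ∀ x ∈ F, hg.IsThin x ↔ hg.IsThin (α x) := by
    intro x hx
    rw [IsThin, IsThin, c.star_eq, c.star_eq, ← hmul x hx x hx]
    constructor
    · intro h
      rw [h, Set.image_singleton, he]
    · intro h
      refine (hg.hmul_nonempty x x).subset_singleton_iff.1 fun y hy => ?_
      refine hbij.injOn (hclosed x hx x hx hy) heF ?_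
      rw [he]
      exact h.subset (Set.mem_image_of_mem α hy)
  have himage : {x ∈ G | hg.IsThin x} = α '' {x ∈ F | hg.IsThin x} := by
    ext y
    constructor
    · rintro ⟨hy, hthin⟩
      obtain ⟨x, hx, rfl⟩ := hbij.surjOn hy
      exact ⟨x, ⟨hx, (key x hx).2 hthin⟩, rfl⟩
    · rintro ⟨x, ⟨hx, hthin⟩, rfl⟩
      exact ⟨hbij.mapsTo hx, (key x hx).1 hthin⟩
  rw [himage, (hbij.injOn.mono (Set.sep_subset _ _)).ncard_image]

theorem isomorphic_box_iff [Finite T] [Finite I] {S S' : Finset I}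
    {W W' : Submodule (ZMod 2) (T → ZMod 2)} :
    hg.Isomorphic (c.box S W) (c.box S' W') ↔ S.card = S'.card ∧
      Module.finrank (ZMod 2) W = Module.finrank (ZMod 2) W' := by
  refine ⟨?_, fun h => c.isomorphic_box h.1 h.2⟩
  rintro ⟨α, hα⟩
  have h1 := c.ncard_isThin_eq_of_isIso (c.isClosed_box S W) hα
  rw [c.setOf_isThin_box, c.setOf_isThin_box, c.ncard_box_eq_iff, Finset.card_empty, zero_add,
    zero_add] at h1
  have h2 : (c.box S W).ncard = (c.box S' W').ncard := by
    rw [← hα.1.image_eq, hα.1.injOn.ncard_image]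
  rw [c.ncard_box_eq_iff] at h2
  exact ⟨by omega, h1⟩

theorem setOf_isomorphic_box [Finite T] [Finite I] (S : Finset I)
    (W : Submodule (ZMod 2) (T → ZMod 2)) :
    {G | hg.IsClosed G ∧ hg.Isomorphic (c.box S W) G} =
      (fun p : Finset I × Submodule (ZMod 2) (T → ZMod 2) => c.box p.1 p.2) ''
        ({S' : Finset I | S'.card = S.card} ×ˢ
          {W' : Submodule (ZMod 2) (T → ZMod 2) |
            Module.finrank (ZMod 2) W' = Module.finrank (ZMod 2) W}) := by
  ext G
  constructor
  · rintro ⟨hG, hiso⟩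
    obtain ⟨S', W', rfl⟩ := c.exists_eq_box hG
    rw [c.isomorphic_box_iff] at hiso
    exact ⟨(S', W'), ⟨hiso.1.symm, hiso.2.symm⟩, rfl⟩
  · rintro ⟨⟨S', W'⟩, ⟨h1, h2⟩, rfl⟩
    exact ⟨c.isClosed_box _ _, c.isomorphic_box_iff.2 ⟨Eq.symm h1, Eq.symm h2⟩⟩

theorem ncard_setOf_isomorphic_box [Finite T] [Finite I] (S : Finset I)
    (W : Submodule (ZMod 2) (T → ZMod 2)) :
    {G | hg.IsClosed G ∧ hg.Isomorphic (c.box S W) G}.ncard =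
      (Nat.card I).choose S.card * gaussBinom2 (Nat.card T) (Module.finrank (ZMod 2) W) := by
  have := Fintype.ofFinite I
  have := Fintype.ofFinite T
  rw [c.setOf_isomorphic_box, Set.ncard_image_of_injective _ c.box_injective, Set.ncard_prod,
    card_submodule_finrank_eq, Module.finrank_fintype_fun_eq_card, Nat.card_eq_fintype_card,
    Nat.card_eq_fintype_card]
  congr 1
  rw [← Finset.card_univ, ← Finset.card_powersetCard,
    ← Set.ncard_coe_finset (Finset.powersetCard S.card Finset.univ)]
  congr 1
  ext S'
  simp

theorem ncard_isomorphism_classes (c : hg.Coordinates I T) [Finite T] [Finite I] :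
    {C : Set (Set H) | ∃ D : Set H, hg.IsClosed D ∧
        C = {G : Set H | hg.IsClosed G ∧ hg.Isomorphic D G}}.ncard =
      (Nat.card I + 1) * (Nat.card T + 1) := by
  have := Fintype.ofFinite I
  have := Fintype.ofFinite T
  let cls : ℕ × ℕ → Set (Set H) := fun a =>
    (fun p : Finset I × Submodule (ZMod 2) (T → ZMod 2) => c.box p.1 p.2) ''
        ({S : Finset I | S.card = a.1} ×ˢ
          {W : Submodule (ZMod 2) (T → ZMod 2) | Module.finrank (ZMod 2) W = a.2})
  let R : Finset (ℕ × ℕ) :=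
    Finset.range (Fintype.card I + 1) ×ˢ Finset.range (Fintype.card T + 1)
  have hexists : ∀ a ∈ R, ∃ (S : Finset I) (W : Submodule (ZMod 2) (T → ZMod 2)),
      S.card = a.1 ∧ Module.finrank (ZMod 2) W = a.2 := by
    intro a ha
    simp only [R, Finset.mem_product, Finset.mem_range, Nat.lt_succ_iff] at ha
    obtain ⟨S, -, hS⟩ := Finset.exists_subset_card_eq (s := (Finset.univ : Finset I)) ha.1
    obtain ⟨W, hW⟩ := exists_submodule_finrank_eq (K := ZMod 2) (V := T → ZMod 2) (k := a.2)
      (by rw [Module.finrank_fintype_fun_eq_card]; exact ha.2)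
    exact ⟨S, W, hS, hW⟩
  have hclasses : {C : Set (Set H) | ∃ D : Set H, hg.IsClosed D ∧
      C = {G : Set H | hg.IsClosed G ∧ hg.Isomorphic D G}} = cls '' R := by
    ext C
    constructor
    · rintro ⟨D, hD, rfl⟩
      obtain ⟨S, W, rfl⟩ := c.exists_eq_box hD
      refine ⟨(S.card, Module.finrank (ZMod 2) W), ?_, (c.setOf_isomorphic_box S W).symm⟩
      have hW := Submodule.finrank_le W
      rw [Module.finrank_fintype_fun_eq_card] at hW
      simpa [R, Nat.lt_succ_iff] using ⟨S.card_le_univ, hW⟩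
    · rintro ⟨a, ha, rfl⟩
      obtain ⟨S, W, hS, hW⟩ := hexists a ha
      refine ⟨c.box S W, c.isClosed_box S W, ?_⟩
      rw [c.setOf_isomorphic_box, hS, hW]
  have hinj : Set.InjOn cls R := by
    intro a ha b hb hab
    obtain ⟨S, W, hS, hW⟩ := hexists a ha
    have h : c.box S W ∈ cls b := by
      rw [← hab]
      exact ⟨(S, W), ⟨hS, hW⟩, rfl⟩
    obtain ⟨p, ⟨hp1, hp2⟩, hp⟩ := h
    obtain rfl : p = (S, W) := c.box_injective hp
    exact Prod.ext (hS.symm.trans hp1) (hW.symm.trans hp2)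
  rw [hclasses, hinj.ncard_image, Set.ncard_coe_finset, Finset.card_product,
    Finset.card_range, Finset.card_range, Nat.card_eq_fintype_card, Nat.card_eq_fintype_card]

end Coordinates

end Hypergroup

namespace Hypergroup

variable {H : Type*} (hg : Hypergroup H)

theorem star_e : hg.star hg.e = hg.e := by
  have h : hg.e ∈ hg.hmul hg.e hg.e := by simp [hg.idl]
  exact (hg.e_mem_hmul_iff.1 h).symm

theorem star_eq_self_of_isInvolution {q : H} (hq : hg.IsInvolution q) : hg.star q = q := by
  have he := hg.e_mem_of_isClosed hq.2
  have h : hg.star q ∈ ({hg.e, q} : Set H) :=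
    hq.2.2 ⟨_, ⟨q, by simp, rfl⟩, hg.e, he, by simp [hg.idr]⟩
  rcases h with h | h
  · have h' := hg.e_mem_star_hmul q
    rw [h, hg.idl, Set.mem_singleton_iff] at h'
    exact absurd h'.symm hq.1
  · exact h

theorem gen_singleton_of_isInvolution {q : H} (hq : hg.IsInvolution q) :
    hg.gen {q} = {hg.e, q} := by
  refine Set.Subset.antisymm (Set.sInter_subset_of_mem ⟨hq.2, by simp⟩) ?_
  rintro x hx C ⟨hC, hqC⟩
  rcases hx with rfl | rfl
  · exact hg.e_mem_of_isClosed hC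
  · exact hqC rfl

theorem smul_singleton (p q : H) : hg.smul {p} {q} = hg.hmul p q := by
  simp [smul]

/-- The complex product makes the subsets of a hypergroup a monoid. -/
@[reducible]
def setMonoid : Monoid (Set H) where
  mul := hg.smul
  one := {hg.e}
  mul_assoc F G K := by
    ext a
    constructor
    · rintro ⟨x, ⟨p, hp, q, hq, hx⟩, r, hr, ha⟩
      have h : a ∈ ⋃ x ∈ hg.hmul p q, hg.hmul x r := Set.mem_biUnion hx ha
      rw [hg.assoc] at h
      obtain ⟨y, hy, ha'⟩ := Set.mem_iUnion₂.1 h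
      exact ⟨p, hp, y, ⟨q, hq, r, hr, hy⟩, ha'⟩
    · rintro ⟨p, hp, y, ⟨q, hq, r, hr, hy⟩, ha⟩
      have h : a ∈ ⋃ x ∈ hg.hmul q r, hg.hmul p x := Set.mem_biUnion hy ha
      rw [← hg.assoc] at h
      obtain ⟨x, hx, ha'⟩ := Set.mem_iUnion₂.1 h
      exact ⟨x, ⟨p, hp, q, hq, hx⟩, r, hr, ha'⟩
  one_mul F := by
    ext a
    constructor
    · rintro ⟨x, rfl, p, hp, ha⟩
      rw [hg.idl] at ha
      exact ha ▸ hp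
    · exact fun ha => ⟨_, rfl, a, ha, by simp [hg.idl]⟩
  mul_one F := by
    ext a
    constructor
    · rintro ⟨p, hp, x, rfl, ha⟩
      rw [hg.idr] at ha
      exact ha ▸ hp
    · exact fun ha => ⟨a, ha, _, rfl, by simp [hg.idr]⟩

theorem listProd_eq_prod (l : List (Set H)) :
    hg.listProd l = @List.prod _ hg.setMonoid.toMul hg.setMonoid.toOne l := by
  let _ := hg.setMonoid
  induction l with
  | nil => rfl
  | cons a l ih => rw [listProd, ih, List.prod_cons]; rfl

theorem listProd_map_smul {ι : Type*} (l : List ι) (f g : ι → Set H)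
    (h : ∀ i j, i ≠ j → hg.smul (f i) (g j) = hg.smul (g j) (f i)) (hl : l.Nodup) :
    hg.listProd (l.map fun i => hg.smul (f i) (g i)) =
      hg.smul (hg.listProd (l.map f)) (hg.listProd (l.map g)) := by
  let _ := hg.setMonoid
  simp only [listProd_eq_prod]
  change (l.map fun i => f i * g i).prod = (l.map f).prod * (l.map g).prod
  induction l with
  | nil => simp
  | cons a l ih =>
    rw [List.nodup_cons] at hl
    have hc : Commute (l.map f).prod (g a) := by
      refine (Commute.list_prod_right _ _ fun x hx => ?_).symm
      obtain ⟨i, hi, rfl⟩ := List.mem_map.1 hx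
      exact (h i a fun hia => hl.1 (hia ▸ hi)).symm
    simp only [List.map_cons, List.prod_cons, ih hl.2]
    rw [mul_assoc, ← mul_assoc (g a), ← hc.eq, mul_assoc, mul_assoc]

theorem listProd_perm {l l' : List (Set H)} (h : l.Perm l')
    (hc : l.Pairwise fun F G => hg.smul F G = hg.smul G F) : hg.listProd l = hg.listProd l' := by
  let _ := hg.setMonoid
  simp only [listProd_eq_prod]
  exact h.prod_eq' hc

theorem mem_listProd_map {ι : Type*} (l : List ι) (X : ι → Set H) (hl : l.Nodup) (x : H) :
    x ∈ hg.listProd (l.map X) ↔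
      ∃ r : ι → H, (∀ i ∈ l, r i ∈ X i) ∧ x ∈ hg.listProd (l.map fun i => {r i}) := by
  classical
  induction l generalizing x with
  | nil => exact ⟨fun h => ⟨fun _ => hg.e, by simp, h⟩, fun ⟨_, _, h⟩ => h⟩
  | cons a l ih =>
    rw [List.nodup_cons] at hl
    constructor
    · rintro ⟨b, hb, y, hy, hx⟩
      obtain ⟨r, hr, hy⟩ := (ih hl.2 y).1 hy
      have hne : ∀ i ∈ l, i ≠ a := fun i hi hia => hl.1 (hia ▸ hi)
      refine ⟨Function.update r a b, fun i hi => ?_, b, by simp, y, ?_, hx⟩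
      · rcases List.mem_cons.1 hi with rfl | hi
        · simpa using hb
        · simpa [hne i hi] using hr i hi
      · rwa [List.map_congr_left fun i hi => by rw [Function.update_of_ne (hne i hi)]]
    · rintro ⟨r, hr, b, hb, y, hy, hx⟩
      rw [Set.mem_singleton_iff] at hb
      subst hb
      exact ⟨r a, hr a (by simp), y,
        (ih hl.2 y).2 ⟨r, fun i hi => hr i (List.mem_cons_of_mem _ hi), hy⟩, hx⟩

theorem e_mem_listProd {l : List (Set H)} (h : ∀ F ∈ l, hg.e ∈ F) : hg.e ∈ hg.listProd l := by
  induction l with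
  | nil => rfl
  | cons F l ih =>
    rw [List.forall_mem_cons] at h
    exact ⟨_, h.1, _, ih h.2, by simp [hg.idl]⟩

theorem subset_listProd {l : List (Set H)} (h : ∀ F ∈ l, hg.e ∈ F) {G : Set H} (hG : G ∈ l) :
    G ⊆ hg.listProd l := by
  induction l with
  | nil => simp at hG
  | cons F l ih =>
    rw [List.forall_mem_cons] at h
    intro x hx
    rcases List.mem_cons.1 hG with rfl | hG
    · exact ⟨x, hx, _, hg.e_mem_listProd h.2, by simp [hg.idr]⟩
    · exact ⟨_, h.1, x, ih h.2 hG hx, by simp [hg.idl]⟩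

theorem listProd_nonempty {l : List (Set H)} (h : ∀ F ∈ l, F.Nonempty) :
    (hg.listProd l).Nonempty := by
  induction l with
  | nil => exact ⟨_, rfl⟩
  | cons F l ih =>
    rw [List.forall_mem_cons] at h
    obtain ⟨x, hx⟩ := h.1
    obtain ⟨y, hy⟩ := ih h.2
    obtain ⟨z, hz⟩ := hg.hmul_nonempty x y
    exact ⟨z, x, hx, y, hy, hz⟩

end Hypergroup

namespace EA2Data

variable {H : Type*} (E : EA2Data H)

theorem fam_eq (i : Fin E.n) : E.fam i = {E.hg.e, E.q i} :=
  E.hg.gen_singleton_of_isInvolution (E.invol i)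

theorem q_ne_e (i : Fin E.n) : E.q i ≠ E.hg.e := (E.invol i).1

theorem star_q (i : Fin E.n) : E.hg.star (E.q i) = E.q i :=
  E.hg.star_eq_self_of_isInvolution (E.invol i)

theorem e_mem_fam (i : Fin E.n) : E.hg.e ∈ E.fam i := by simp [fam_eq]

theorem q_mem_fam (i : Fin E.n) : E.q i ∈ E.fam i := by simp [fam_eq]

theorem q_notMem_cofactor (i : Fin E.n) : E.q i ∉ E.hg.cofactor E.fam i := fun h =>
  E.q_ne_e i ((E.dp.2.2 i).subset ⟨E.q_mem_fam i, h⟩)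

theorem fam_subset_cofactor {i j : Fin E.n} (h : i ≠ j) :
    E.fam j ⊆ E.hg.cofactor E.fam i := by
  refine E.hg.subset_listProd ?_ (List.mem_map_of_mem (by simpa using h.symm))
  simp only [List.mem_map]
  rintro _ ⟨k, -, rfl⟩
  exact E.e_mem_fam k

theorem q_notMem_fam {i j : Fin E.n} (h : i ≠ j) : E.q i ∉ E.fam j := fun hq =>
  E.q_notMem_cofactor i (E.fam_subset_cofactor h hq)

theorem q_injective : Function.Injective E.q := fun i j h => by
  by_contra hij
  exact E.q_notMem_fam hij (h ▸ E.q_mem_fam j)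

theorem hmul_subset_fam {i : Fin E.n} {x y : H} (hx : x ∈ E.fam i) (hy : y ∈ E.fam i) :
    E.hg.hmul x y ⊆ E.fam i := by
  intro z hz
  rw [fam_eq] at *
  refine (E.invol i).2.2 ⟨x, ⟨x, hx, ?_⟩, y, hy, hz⟩
  rcases hx with rfl | rfl
  · exact E.hg.star_e
  · exact E.star_q i

theorem hmul_comm_of_ne {i j : Fin E.n} (hij : i ≠ j) {x y : H} (hx : x ∈ E.fam i)
    (hy : y ∈ E.fam j) : E.hg.hmul x y = E.hg.hmul y x := by
  have key : ∀ {i j : Fin E.n}, i ≠ j →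
      E.hg.hmul (E.q i) (E.q j) ⊆ E.hg.hmul (E.q j) (E.q i) := by
    intro i j hij z hz
    have h : z ∈ E.hg.smul (E.fam i) {E.q j} := ⟨_, E.q_mem_fam i, _, rfl, hz⟩
    have hn : E.hg.smul (E.fam i) {E.q j} = E.hg.smul {E.q j} (E.fam i) :=
      (E.dp.1 i).2.2.2 (E.q j) (Set.mem_univ _)
    rw [hn, fam_eq] at h
    obtain ⟨_, rfl, y, rfl | rfl, h⟩ := h
    · rw [E.hg.idr, Set.mem_singleton_iff] at h
      rw [h, E.hg.h3l, star_q] at hz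
      exact absurd (E.hmul_subset_fam (E.q_mem_fam j) (E.q_mem_fam j) hz) (E.q_notMem_fam hij)
    · exact h
  rw [fam_eq] at hx hy
  rcases hx with rfl | rfl
  · rw [E.hg.idl, E.hg.idr]
  rcases hy with rfl | rfl
  · rw [E.hg.idl, E.hg.idr]
  exact (key hij).antisymm (key hij.symm)

open Classical in
/-- The choice of factors `q i` for the indices `i` satisfying `A`, and `e` for the others. -/
noncomputable def factors (A : Fin E.n → Prop) (i : Fin E.n) : H :=
  if A i then E.q i else E.hg.e

variable {E} in
theorem factors_of {A : Fin E.n → Prop} {i : Fin E.n} (h : A i) : E.factors A i = E.q i :=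
  if_pos h

variable {E} in
theorem factors_of_not {A : Fin E.n → Prop} {i : Fin E.n} (h : ¬A i) :
    E.factors A i = E.hg.e :=
  if_neg h

theorem factors_mem_fam (A : Fin E.n → Prop) (i : Fin E.n) : E.factors A i ∈ E.fam i := by
  by_cases h : A i
  · exact factors_of h ▸ E.q_mem_fam i
  · exact factors_of_not h ▸ E.e_mem_fam i

theorem eq_factors {r : Fin E.n → H} (hr : ∀ i, r i ∈ E.fam i) :
    r = E.factors fun i => r i = E.q i := by
  funext i
  by_cases h : r i = E.q i
  · rw [factors_of h, h]
  · rw [factors_of_not h]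
    have hi := hr i
    rw [fam_eq] at hi
    exact hi.resolve_right h

theorem e_mem_hmul_q (i : Fin E.n) : E.hg.e ∈ E.hg.hmul (E.q i) (E.q i) :=
  E.hg.e_mem_hmul_iff.2 (E.star_q i).symm

theorem q_mem_hmul_q_iff (i : Fin E.n) :
    E.q i ∈ E.hg.hmul (E.q i) (E.q i) ↔ E.hg.IsThick (E.q i) := by
  rw [Hypergroup.IsThick, Hypergroup.IsThin, star_q]
  constructor
  · intro h h'
    rw [h'] at h
    exact E.q_ne_e i h
  · intro h
    by_contra hq
    refine h (Set.Subset.antisymm (fun x hx => ?_) (Set.singleton_subset_iff.2 (E.e_mem_hmul_q i)))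
    have hx' := E.hmul_subset_fam (E.q_mem_fam i) (E.q_mem_fam i) hx
    rw [fam_eq] at hx'
    refine hx'.resolve_right fun hxq => hq ?_
    rw [Set.mem_singleton_iff] at hxq
    rwa [hxq] at hx

theorem factors_mem_hmul_iff {A B C : Fin E.n → Prop} {i : Fin E.n} :
    E.factors C i ∈ E.hg.hmul (E.factors A i) (E.factors B i) ↔
      ((A i ↔ B i) ∨ C i) ∧ (C i → A i ∨ B i) ∧ (A i → B i → C i → E.hg.IsThick (E.q i)) := by
  by_cases hA : A i <;> by_cases hB : B i <;> by_cases hC : C i <;>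
    simp [factors, hA, hB, hC, E.hg.idl, E.hg.idr, E.q_ne_e i, (E.q_ne_e i).symm,
      E.e_mem_hmul_q, E.q_mem_hmul_q_iff]

theorem exists_famProd_factors_eq (A : Fin E.n → Prop) :
    ∃ x, E.hg.famProd (E.factors A) = {x} := by
  obtain ⟨x, hx⟩ : (E.hg.famProd (E.factors A)).Nonempty := by
    refine E.hg.listProd_nonempty ?_
    simp only [List.mem_map]
    rintro _ ⟨i, -, rfl⟩
    exact Set.singleton_nonempty _
  refine ⟨x, Set.Subset.antisymm (fun y hy => ?_) (Set.singleton_subset_iff.2 hx)⟩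
  exact (E.constrained x).subset ⟨_, ⟨E.factors_mem_fam A, hx⟩, hy⟩

/-- The product of the involutions `q i` over the indices `i` satisfying `A`. -/
noncomputable def prodElem (A : Fin E.n → Prop) : H := (E.exists_famProd_factors_eq A).choose

theorem famProd_factors (A : Fin E.n → Prop) :
    E.hg.famProd (E.factors A) = {E.prodElem A} :=
  (E.exists_famProd_factors_eq A).choose_spec

theorem prodElem_surjective : Function.Surjective E.prodElem := by
  intro x
  obtain ⟨r, hr, -⟩ := (E.constrained x).superset rfl
  have hx := hr.2
  rw [E.eq_factors hr.1, famProd_factors] at hx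
  exact ⟨_, hx.symm⟩

theorem mem_hmul_prodElem_iff_exists {A B : Fin E.n → Prop} {x : H} :
    x ∈ E.hg.hmul (E.prodElem A) (E.prodElem B) ↔
      ∃ C, (∀ i, E.factors C i ∈ E.hg.hmul (E.factors A i) (E.factors B i)) ∧
        x = E.prodElem C := by
  have h := E.hg.listProd_map_smul (List.finRange E.n) (fun i => {E.factors A i})
    (fun i => {E.factors B i}) (fun i j hij => by
      rw [E.hg.smul_singleton, E.hg.smul_singleton,
        E.hmul_comm_of_ne hij (E.factors_mem_fam A i) (E.factors_mem_fam B j)])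
    (List.nodup_finRange _)
  rw [← Hypergroup.famProd, ← Hypergroup.famProd, famProd_factors, famProd_factors,
    Hypergroup.smul_singleton] at h
  rw [← h, E.hg.mem_listProd_map _ _ (List.nodup_finRange _)]
  simp only [Hypergroup.smul_singleton]
  constructor
  · rintro ⟨r, hr, hx⟩
    have hr' : ∀ i, r i ∈ E.hg.hmul (E.factors A i) (E.factors B i) :=
      fun i => hr i (List.mem_finRange i)
    have hrC := E.eq_factors fun i =>
      E.hmul_subset_fam (E.factors_mem_fam A i) (E.factors_mem_fam B i) (hr' i)
    rw [← Hypergroup.famProd, hrC, famProd_factors] at hx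
    exact ⟨_, fun i => hrC ▸ hr' i, hx⟩
  · rintro ⟨C, hC, rfl⟩
    refine ⟨_, fun i _ => hC i, ?_⟩
    rw [← Hypergroup.famProd, famProd_factors]
    rfl

theorem not_of_prodElem_eq_e {C : Fin E.n → Prop} (h : E.prodElem C = E.hg.e) (i : Fin E.n) :
    ¬C i := by
  intro hi
  have he : E.hg.e ∈ E.hg.famProd (E.factors C) := by rw [famProd_factors, h]; rfl
  have hperm : (List.finRange E.n).Perm
      (i :: (List.finRange E.n).filter fun j => decide (j ≠ i)) := by
    rw [List.perm_ext_iff_of_nodup (List.nodup_finRange _)]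
    · intro j
      simp [em]
    · exact List.nodup_cons.2 ⟨by simp, (List.nodup_finRange _).filter _⟩
  rw [Hypergroup.famProd, E.hg.listProd_perm (hperm.map _)] at he
  · obtain ⟨x, hx, y, hy, he⟩ := he
    rw [Set.mem_singleton_iff, factors_of hi] at hx
    rw [hx, E.hg.h3r, E.hg.idr, star_q, Set.mem_singleton_iff] at he
    refine E.q_notMem_cofactor i (he ▸ ?_)
    exact (E.hg.mem_listProd_map _ _ ((List.nodup_finRange _).filter _) y).2
      ⟨_, fun j _ => E.factors_mem_fam C j, hy⟩
  · refine List.pairwise_map.2 ((List.nodup_finRange _).imp fun {j k} hjk => ?_)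
    rw [E.hg.smul_singleton, E.hg.smul_singleton,
      E.hmul_comm_of_ne hjk (E.factors_mem_fam C j) (E.factors_mem_fam C k)]

theorem prodElem_false : E.prodElem (fun _ => False) = E.hg.e := by
  have h : E.hg.e ∈ E.hg.famProd (E.factors fun _ => False) := by
    refine E.hg.e_mem_listProd ?_
    simp only [List.mem_map]
    rintro _ ⟨i, -, rfl⟩
    exact (factors_of_not (E := E) (A := fun _ => False) id).symm
  rw [famProd_factors] at h
  exact h.symm

theorem prodElem_injective : Function.Injective E.prodElem := by
  intro A B hAB
  have hself : E.hg.e ∈ E.hg.hmul (E.prodElem A) (E.prodElem A) :=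
    E.mem_hmul_prodElem_iff_exists.2 ⟨_, fun i => E.factors_mem_hmul_iff.2 (by simp),
      E.prodElem_false.symm⟩
  nth_rewrite 2 [hAB] at hself
  obtain ⟨C, hC, he⟩ := E.mem_hmul_prodElem_iff_exists.1 hself
  have hC' := E.not_of_prodElem_eq_e he.symm
  funext i
  exact propext (((E.factors_mem_hmul_iff.1 (hC i)).1).resolve_right (hC' i))

theorem prodElem_mem_hmul_iff {A B C : Fin E.n → Prop} :
    E.prodElem C ∈ E.hg.hmul (E.prodElem A) (E.prodElem B) ↔
      ∀ i, ((A i ↔ B i) ∨ C i) ∧ (C i → A i ∨ B i) ∧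
        (A i → B i → C i → E.hg.IsThick (E.q i)) := by
  simp only [mem_hmul_prodElem_iff_exists, E.prodElem_injective.eq_iff, ← factors_mem_hmul_iff]
  exact ⟨fun ⟨_, h, hC⟩ => hC ▸ h, fun h => ⟨C, h, rfl⟩⟩

theorem support_prodElem (A : Fin E.n → Prop) : E.support (E.prodElem A) = E.q '' {i | A i} := by
  ext y
  constructor
  · rintro ⟨hy, r, ⟨hr, hx⟩, i, rfl⟩
    have hi : r i = E.q i := by
      have h : r i ∈ E.fam i := hr i
      rw [fam_eq] at h
      exact h.resolve_left hy
    rw [E.eq_factors hr, famProd_factors, Set.mem_singleton_iff, E.prodElem_injective.eq_iff] at hx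
    exact ⟨i, by rw [hx]; exact hi, hi.symm⟩
  · rintro ⟨i, hi, rfl⟩
    exact ⟨E.q_ne_e i, _, ⟨E.factors_mem_fam A, by rw [famProd_factors]; rfl⟩, i, factors_of hi⟩

/-- The indices of the thick involutions. -/
abbrev ThickIndex := {i : Fin E.n // E.hg.IsThick (E.q i)}

/-- The indices of the thin involutions. -/
abbrev ThinIndex := {i : Fin E.n // ¬E.hg.IsThick (E.q i)}

open Classical in
/-- The index predicate given by its thick part and its thin part. -/
def indexPred (p : Finset E.ThickIndex × (E.ThinIndex → ZMod 2)) (i : Fin E.n) : Prop :=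
  if h : E.hg.IsThick (E.q i) then ⟨i, h⟩ ∈ p.1 else p.2 ⟨i, h⟩ = 1

variable {E} in
theorem indexPred_thick {p : Finset E.ThickIndex × (E.ThinIndex → ZMod 2)} (i : E.ThickIndex) :
    E.indexPred p i ↔ i ∈ p.1 := by
  simp [indexPred, i.2]

variable {E} in
theorem indexPred_thin {p : Finset E.ThickIndex × (E.ThinIndex → ZMod 2)} (i : E.ThinIndex) :
    E.indexPred p i ↔ p.2 i = 1 := by
  simp [indexPred, i.2]

theorem indexPred_bijective : Function.Bijective E.indexPred := by
  classical
  constructor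
  · rintro ⟨A, u⟩ ⟨B, v⟩ h
    have hi : ∀ i, E.indexPred (A, u) i ↔ E.indexPred (B, v) i := fun i => by rw [h]
    refine Prod.ext (Finset.ext fun i => ?_) (funext fun i => ?_)
    · simpa only [indexPred_thick] using hi i
    · have h2 : ∀ a b : ZMod 2, (a = 1 ↔ b = 1) → a = b := by decide
      exact h2 _ _ (by simpa only [indexPred_thin] using hi i)
  · intro P
    refine ⟨(Finset.univ.filter fun i => P i, fun i => if P i then 1 else 0), ?_⟩
    funext i
    by_cases h : E.hg.IsThick (E.q i)
    · exact propext ((indexPred_thick ⟨i, h⟩).trans (by simp))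
    · exact propext ((indexPred_thin ⟨i, h⟩).trans (by simp))

/-- The coordinates of an elementary abelian 2-hypergroup. -/
noncomputable def coordinates : E.hg.Coordinates E.ThickIndex E.ThinIndex where
  toEquiv := (Equiv.ofBijective _ E.indexPred_bijective).trans
    (Equiv.ofBijective _ ⟨E.prodElem_injective, E.prodElem_surjective⟩)
  mem_hmul A B C u v w := by
    have hthin : ∀ a b c : ZMod 2, (((a = 1 ↔ b = 1) ∨ c = 1) ∧ (c = 1 → a = 1 ∨ b = 1) ∧
        (a = 1 → b = 1 → ¬c = 1)) ↔ c = a + b := by decide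
    refine (E.prodElem_mem_hmul_iff (A := E.indexPred (A, u)) (B := E.indexPred (B, v))
      (C := E.indexPred (C, w))).trans ?_
    constructor
    · intro h
      refine ⟨fun i => ?_, fun i => ?_, funext fun i => (hthin _ _ _).1 ?_⟩
      · simpa only [indexPred_thick] using (h i).1
      · simpa only [indexPred_thick] using (h i).2.1
      · simpa only [indexPred_thin, i.2, imp_false] using h i
    · rintro ⟨h1, h2, rfl⟩ i
      by_cases hi : E.hg.IsThick (E.q i)
      · lift i to E.ThickIndex using hi
        simp only [indexPred_thick]
        exact ⟨h1 i, h2 i, fun _ _ _ => i.2⟩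
      · lift i to E.ThinIndex using hi
        simp only [indexPred_thin, i.2, imp_false]
        exact (hthin _ _ _).2 rfl

theorem sElem_coordinates (A : Finset E.ThickIndex) (u : E.ThinIndex → ZMod 2) :
    E.sElem (E.coordinates.toEquiv (A, u)) = A.card := by
  have h : {y ∈ E.support (E.coordinates.toEquiv (A, u)) | E.hg.IsThick y} =
      (E.q ∘ Subtype.val) '' (A : Set E.ThickIndex) := by
    change {y ∈ E.support (E.prodElem (E.indexPred (A, u))) | E.hg.IsThick y} = _
    rw [support_prodElem]
    ext y
    constructor
    · rintro ⟨⟨i, hi, rfl⟩, hthick⟩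
      exact ⟨⟨i, hthick⟩, (indexPred_thick ⟨i, hthick⟩).1 hi, rfl⟩
    · rintro ⟨i, hi, rfl⟩
      exact ⟨⟨i, (indexPred_thick i).2 hi, rfl⟩, i.2⟩
  rw [sElem, h, Set.ncard_image_of_injective _ (E.q_injective.comp Subtype.val_injective),
    Set.ncard_coe_finset]

theorem sSet_box (S : Finset E.ThickIndex) (W : Submodule (ZMod 2) (E.ThinIndex → ZMod 2)) :
    E.sSet (E.coordinates.box S W) = S.card := by
  refine IsGreatest.csSup_eq ⟨⟨_, E.coordinates.mem_box.2 ⟨subset_rfl, W.zero_mem⟩,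
    E.sElem_coordinates S 0⟩, ?_⟩
  rintro k ⟨x, hx, rfl⟩
  obtain ⟨⟨A, u⟩, rfl⟩ := E.coordinates.toEquiv.surjective x
  rw [sElem_coordinates]
  exact Finset.card_le_card (E.coordinates.mem_box.1 hx).1

theorem card_thickIndex : Nat.card E.ThickIndex = E.psharp := rfl

theorem card_thickIndex_add_card_thinIndex :
    Nat.card E.ThickIndex + Nat.card E.ThinIndex = E.n := by
  classical
  rw [← Nat.card_sum, Nat.card_congr (Equiv.sumCompl _), Nat.card_fin]

end EA2Data

end HyperPaper

/-- For closed subsets F, G of an elementary abelian 2-hypergroup H: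
F ≃ G iff at least two of s(F) = s(G), r_2(F) = r_2(G), |F| = |G| hold; there are exactly
p·p♯ − (p♯)² + p + 1 pairwise distinct ≃-equivalence classes of closed subsets of H; and
the ≃-class of F has cardinality C(p♯, s(F))·C(p−p♯, r_2(F))_2. -/
theorem stmt16 {H : Type*} (E : EA2Data H) (F G : Set H)
    (hF : E.hg.IsClosed F) (hG : E.hg.IsClosed G) :
    (E.hg.Isomorphic F G ↔
      ((E.sSet F = E.sSet G ∧ E.hg.rank2 F = E.hg.rank2 G) ∨
       (E.sSet F = E.sSet G ∧ F.ncard = G.ncard) ∨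
       (E.hg.rank2 F = E.hg.rank2 G ∧ F.ncard = G.ncard))) ∧
    {C : Set (Set H) | ∃ D : Set H, E.hg.IsClosed D ∧
        C = {G' : Set H | E.hg.IsClosed G' ∧ E.hg.Isomorphic D G'}}.ncard
      = E.n * E.psharp - E.psharp ^ 2 + E.n + 1 ∧
    {G' : Set H | E.hg.IsClosed G' ∧ E.hg.Isomorphic F G'}.ncard
      = Nat.choose E.psharp (E.sSet F) * gaussBinom2 (E.n - E.psharp) (E.hg.rank2 F) := by
  obtain ⟨S, W, rfl⟩ := E.coordinates.exists_eq_box hF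
  obtain ⟨S', W', rfl⟩ := E.coordinates.exists_eq_box hG
  have hcard := E.card_thickIndex_add_card_thinIndex
  rw [E.card_thickIndex] at hcard
  have hthin : Nat.card E.ThinIndex = E.n - E.psharp := by omega
  refine ⟨?_, ?_, ?_⟩
  · rw [E.coordinates.isomorphic_box_iff, E.coordinates.ncard_box_eq_iff, E.sSet_box, E.sSet_box,
      E.coordinates.rank2_box, E.coordinates.rank2_box]
    omega
  · rw [E.coordinates.ncard_isomorphism_classes, E.card_thickIndex, ← hcard,
      show (E.psharp + Nat.card E.ThinIndex) * E.psharp =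
        Nat.card E.ThinIndex * E.psharp + E.psharp ^ 2 by ring, Nat.add_sub_cancel]
    ring
  · rw [E.coordinates.ncard_setOf_isomorphic_box, E.sSet_box, E.coordinates.rank2_box,
      E.card_thickIndex, hthin]
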